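/- arXiv:2310.19847 — 2 statements merged into one kernel-verified Lean document; each statement's English description precedes it below -/
import Mathlib

section
/- ∫₀^∞ tanh(z)⁴/z² dz = 56 ζ(3)/(3π²) - 124 ζ(5)/π⁴. -/
open Real MeasureTheory
open Filter Topology

theorem tendsto_div_one_add_sq_pow (n : ℕ) :
    Tendsto (fun x : ℝ => x / (1 + x ^ 2) ^ (n + 1)) atTop (𝓝 0) := by
  refine squeeze_zero' (g := fun x : ℝ => x⁻¹) ?_ ?_ tendsto_inv_atTop_zero
  · filter_upwards [eventually_ge_atTop 0] with x hx
    positivity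
  · filter_upwards [eventually_gt_atTop 0] with x hx
    rw [inv_eq_one_div, div_le_div_iff₀ (by positivity) hx]
    have : (1 + x ^ 2) ^ 1 ≤ (1 + x ^ 2) ^ (n + 1) :=
      pow_le_pow_right₀ (by nlinarith) (by omega)
    nlinarith

/-- A primitive of `(3 + x²) / (1 + x²)²`. -/
noncomputable def primTwo (x : ℝ) : ℝ := 2 * arctan x + x / (1 + x ^ 2) ^ 1

/-- A primitive of `(10 + 5x² + 4x⁴ + x⁶) / (1 + x²)⁴`. -/
noncomputable def primFour (x : ℝ) : ℝ :=
  4 * arctan x + 3 * (x / (1 + x ^ 2) ^ 1) + 5 / 3 * (x / (1 + x ^ 2) ^ 2)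
    + 4 / 3 * (x / (1 + x ^ 2) ^ 3)

theorem hasDerivAt_div_one_add_sq_pow (n : ℕ) (x : ℝ) :
    HasDerivAt (fun x : ℝ => x / (1 + x ^ 2) ^ (n + 1))
      ((1 + x ^ 2 - 2 * (n + 1) * x ^ 2) / (1 + x ^ 2) ^ (n + 2)) x := by
  have h0 : (1 + x ^ 2) ≠ 0 := by positivity
  have h := (hasDerivAt_id x).fun_div ((((hasDerivAt_id x).fun_pow 2).const_add 1).fun_pow (n + 1))
    (pow_ne_zero _ h0)
  refine h.congr_deriv ?_
  simp only [id, Nat.add_sub_cancel]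
  push_cast
  field_simp
  ring

theorem hasDerivAt_primTwo (x : ℝ) :
    HasDerivAt primTwo ((3 + x ^ 2) / (1 + x ^ 2) ^ 2) x := by
  have h0 : (1 + x ^ 2) ≠ 0 := by positivity
  refine (((hasDerivAt_arctan x).const_mul 2).add
    (hasDerivAt_div_one_add_sq_pow 0 x)).congr_deriv ?_
  push_cast
  field_simp
  ring

theorem hasDerivAt_primFour (x : ℝ) :
    HasDerivAt primFour ((10 + 5 * x ^ 2 + 4 * x ^ 4 + x ^ 6) / (1 + x ^ 2) ^ 4) x := by
  have h0 : (1 + x ^ 2) ≠ 0 := by positivity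
  refine (((((hasDerivAt_arctan x).const_mul 4).add
    ((hasDerivAt_div_one_add_sq_pow 0 x).const_mul 3)).add
    ((hasDerivAt_div_one_add_sq_pow 1 x).const_mul (5 / 3))).add
    ((hasDerivAt_div_one_add_sq_pow 2 x).const_mul (4 / 3))).congr_deriv ?_
  push_cast
  field_simp
  ring

theorem tendsto_primTwo : Tendsto primTwo atTop (𝓝 π) := by
  have h := ((tendsto_arctan_atTop.mono_right nhdsWithin_le_nhds).const_mul 2).add
    (tendsto_div_one_add_sq_pow 0)
  rw [show 2 * (π / 2) + 0 = π by ring] at h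
  exact h

theorem tendsto_primFour : Tendsto primFour atTop (𝓝 (2 * π)) := by
  have h := ((((tendsto_arctan_atTop.mono_right nhdsWithin_le_nhds).const_mul 4).add
    ((tendsto_div_one_add_sq_pow 0).const_mul 3)).add
    ((tendsto_div_one_add_sq_pow 1).const_mul (5 / 3))).add
    ((tendsto_div_one_add_sq_pow 2).const_mul (4 / 3))
  rw [show 4 * (π / 2) + 3 * 0 + 5 / 3 * 0 + 4 / 3 * 0 = 2 * π by ring] at h
  exact h

theorem integrableOn_and_integral_of_scaled_primitive {Φ φ : ℝ → ℝ} {l b c : ℝ} (hb : 0 < b)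
    (hc : 0 ≤ c) (hΦ : ∀ x, HasDerivAt Φ (φ x) x) (hφ : ∀ x, 0 ≤ φ x) (h0 : Φ 0 = 0)
    (hl : Tendsto Φ atTop (𝓝 l)) :
    IntegrableOn (fun z => c * φ (z / b)) (Set.Ioi 0) ∧
      ∫ z in Set.Ioi 0, c * φ (z / b) = c * b * l := by
  have hd : ∀ z ∈ Set.Ici (0 : ℝ),
      HasDerivAt (fun z => c * b * Φ (z / b)) (c * φ (z / b)) z := fun z _ => by
    refine (((hΦ (z / b)).comp z ((hasDerivAt_id z).div_const b)).const_mul (c * b)).congr_deriv ?_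
    field_simp
  have hp : ∀ z ∈ Set.Ioi (0 : ℝ), 0 ≤ c * φ (z / b) := fun z _ => mul_nonneg hc (hφ _)
  have ht : Tendsto (fun z => c * b * Φ (z / b)) atTop (𝓝 (c * b * l)) :=
    (hl.comp (tendsto_id.atTop_div_const hb)).const_mul _
  refine ⟨integrableOn_Ioi_deriv_of_nonneg' hd hp ht, ?_⟩
  rw [integral_Ioi_of_hasDerivAt_of_nonneg' hd hp ht]
  simp [h0]

theorem integrableOn_and_integral_double_pole {b : ℝ} (hb : 0 < b) :
    IntegrableOn (fun z : ℝ => (3 * b ^ 2 + z ^ 2) / (b ^ 2 * (b ^ 2 + z ^ 2) ^ 2)) (Set.Ioi 0) ∧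
      ∫ z in Set.Ioi (0 : ℝ), (3 * b ^ 2 + z ^ 2) / (b ^ 2 * (b ^ 2 + z ^ 2) ^ 2) = π / b ^ 3 := by
  have h := integrableOn_and_integral_of_scaled_primitive hb (c := 1 / b ^ 4) (by positivity)
    hasDerivAt_primTwo (fun x => by positivity) (by simp [primTwo]) tendsto_primTwo
  have e : (fun z : ℝ => 1 / b ^ 4 * ((3 + (z / b) ^ 2) / (1 + (z / b) ^ 2) ^ 2)) =
      fun z => (3 * b ^ 2 + z ^ 2) / (b ^ 2 * (b ^ 2 + z ^ 2) ^ 2) := by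
    ext z
    field_simp
  rw [e] at h
  refine ⟨h.1, h.2.trans ?_⟩
  field_simp

theorem integrableOn_and_integral_quadruple_pole {b : ℝ} (hb : 0 < b) :
    IntegrableOn (fun z : ℝ => (10 * b ^ 6 + 5 * b ^ 4 * z ^ 2 + 4 * b ^ 2 * z ^ 4 + z ^ 6) /
        (b ^ 4 * (b ^ 2 + z ^ 2) ^ 4)) (Set.Ioi 0) ∧
      ∫ z in Set.Ioi (0 : ℝ), (10 * b ^ 6 + 5 * b ^ 4 * z ^ 2 + 4 * b ^ 2 * z ^ 4 + z ^ 6) /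
        (b ^ 4 * (b ^ 2 + z ^ 2) ^ 4) = 2 * π / b ^ 5 := by
  have h := integrableOn_and_integral_of_scaled_primitive hb (c := 1 / b ^ 6) (by positivity)
    hasDerivAt_primFour (fun x => by positivity) (by simp [primFour]) tendsto_primFour
  have e : (fun z : ℝ => 1 / b ^ 6 * ((10 + 5 * (z / b) ^ 2 + 4 * (z / b) ^ 4 + (z / b) ^ 6) /
      (1 + (z / b) ^ 2) ^ 4)) =
      fun z => (10 * b ^ 6 + 5 * b ^ 4 * z ^ 2 + 4 * b ^ 2 * z ^ 4 + z ^ 6) /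
        (b ^ 4 * (b ^ 2 + z ^ 2) ^ 4) := by
    ext z
    field_simp
  rw [e] at h
  refine ⟨h.1, h.2.trans ?_⟩
  field_simp

theorem hasSum_one_div_odd_pow {s : ℕ} {Z : ℝ}
    (h : HasSum (fun n : ℕ => 1 / (n : ℝ) ^ s) Z) :
    HasSum (fun k : ℕ => 1 / (2 * k + 1 : ℝ) ^ s) ((1 - 1 / 2 ^ s) * Z) := by
  have he : HasSum (fun k : ℕ => 1 / ((2 * k : ℕ) : ℝ) ^ s) (1 / 2 ^ s * Z) := by
    have e : (fun k : ℕ => 1 / ((2 * k : ℕ) : ℝ) ^ s) =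
        fun k : ℕ => 1 / 2 ^ s * (1 / (k : ℝ) ^ s) := by
      ext k
      rw [Nat.cast_mul, mul_pow, one_div_mul_one_div, Nat.cast_ofNat]
    rw [e]
    exact h.mul_left _
  have ho : Summable (fun k : ℕ => 1 / ((2 * k + 1 : ℕ) : ℝ) ^ s) :=
    h.summable.comp_injective (i := fun k : ℕ => 2 * k + 1) fun a b hab => by grind
  have hZ := (HasSum.even_add_odd (f := fun n : ℕ => 1 / (n : ℝ) ^ s) he ho.hasSum).unique h
  have e : (∑' k : ℕ, 1 / ((2 * k + 1 : ℕ) : ℝ) ^ s) = (1 - 1 / 2 ^ s) * Z := by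
    linarith
  have := ho.hasSum
  rw [e] at this
  simpa only [Nat.cast_add, Nat.cast_mul, Nat.cast_ofNat, Nat.cast_one] using this

theorem hasSum_one_div_natCast_pow_of_riemannZeta {s : ℕ} (hs : 1 < s) :
    ∃ Z : ℝ, riemannZeta s = Z ∧ HasSum (fun n : ℕ => 1 / (n : ℝ) ^ s) Z := by
  refine ⟨_, ?_, (Real.summable_one_div_nat_pow.mpr hs).hasSum⟩
  rw [zeta_nat_eq_tsum_of_gt_one hs]
  push_cast
  rfl

open UpperHalfPlane in
theorem iteratedDerivWithin_pi_mul_cot_succ {k : ℕ} {p : Polynomial ℂ}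
    (h : Set.EqOn (iteratedDerivWithin k (fun x : ℂ => π * Complex.cot (π * x)) upperHalfPlaneSet)
      (fun x => p.eval (π * Complex.cot (π * x))) upperHalfPlaneSet) :
    Set.EqOn
      (iteratedDerivWithin (k + 1) (fun x : ℂ => π * Complex.cot (π * x)) upperHalfPlaneSet)
      (fun x => -(π ^ 2 + (π * Complex.cot (π * x)) ^ 2) *
        p.derivative.eval (π * Complex.cot (π * x))) upperHalfPlaneSet := by
  intro x hx
  have hs : Complex.sin (π * x) ≠ 0 :=
    sin_pi_mul_ne_zero (UpperHalfPlane.coe_mem_integerComplement ⟨x, hx⟩)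
  have hπ : HasDerivAt (fun x : ℂ => (π : ℂ) * x) π x := by
    simpa using (hasDerivAt_id x).const_mul (π : ℂ)
  have hcot : HasDerivAt (fun x : ℂ => π * Complex.cot (π * x))
      (-(π ^ 2 + (π * Complex.cot (π * x)) ^ 2)) x := by
    have := ((((Complex.hasDerivAt_cos (π * x)).comp x hπ).div
      ((Complex.hasDerivAt_sin (π * x)).comp x hπ) hs).const_mul (π : ℂ))
    refine this.congr_deriv ?_
    simp only [Complex.cot, Function.comp]
    field_simp
    ring
  rw [iteratedDerivWithin_succ, derivWithin_congr h (h hx),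
    derivWithin_of_isOpen isOpen_upperHalfPlaneSet hx]
  refine Eq.trans ?_ (mul_comm _ _)
  exact ((p.hasDerivAt _).comp x hcot).deriv

open UpperHalfPlane Polynomial in
theorem iteratedDerivWithin_one_three_pi_mul_cot {x : ℂ} (hx : x ∈ upperHalfPlaneSet) :
    iteratedDerivWithin 1 (fun x : ℂ => π * Complex.cot (π * x)) upperHalfPlaneSet x =
      -(π ^ 2 + (π * Complex.cot (π * x)) ^ 2) ∧
    iteratedDerivWithin 3 (fun x : ℂ => π * Complex.cot (π * x)) upperHalfPlaneSet x =
      -(π ^ 2 + (π * Complex.cot (π * x)) ^ 2) *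
        (2 * π ^ 2 + 6 * (π * Complex.cot (π * x)) ^ 2) := by
  have h1 := iteratedDerivWithin_pi_mul_cot_succ (k := 0) (p := X) fun x _ => by simp
  have h2 := iteratedDerivWithin_pi_mul_cot_succ (k := 1)
    (p := -(C ((π : ℂ) ^ 2) + X ^ 2)) fun x hx => by
      rw [h1 hx]
      simp
  have h3 := iteratedDerivWithin_pi_mul_cot_succ (k := 2)
    (p := 2 * X * (C ((π : ℂ) ^ 2) + X ^ 2)) fun x hx => by
      rw [h2 hx]
      simp [-map_pow]
      ring
  refine ⟨by simpa using h1 hx, ?_⟩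
  rw [h3 hx]
  simp [-map_pow]
  left
  ring

theorem pi_mul_cot_half_add (z : ℝ) :
    (π * Complex.cot (π * (1 / 2 + z / π * Complex.I))) ^ 2 = -(π ^ 2 * Real.tanh z ^ 2 : ℝ) := by
  have hπ : (π : ℂ) ≠ 0 := by exact_mod_cast pi_ne_zero
  have e : (π : ℂ) * (1 / 2 + z / π * Complex.I) = z * Complex.I + π / 2 := by
    field_simp
    ring
  rw [e, Complex.cot, Complex.cos_add_pi_div_two, Complex.sin_add_pi_div_two, Complex.sin_mul_I,
    Complex.cos_mul_I, mul_pow, div_pow, neg_sq, mul_pow, Complex.I_sq]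
  push_cast
  rw [Complex.tanh_eq_sinh_div_cosh, div_pow]
  ring

theorem hasSum_one_div_half_add_pow (z : ℝ) {k : ℕ} (hk : 1 ≤ k) :
    HasSum (fun n : ℕ => 1 / ((1 / 2 + z / π * Complex.I) + n) ^ (k + 1) +
        1 / ((1 / 2 + z / π * Complex.I) - (n + 1)) ^ (k + 1))
      (∑' n : ℤ, 1 / ((1 / 2 + z / π * Complex.I) + n) ^ (k + 1)) := by
  have h : Summable fun n : ℤ => 1 / ((1 / 2 + z / π * Complex.I) + n) ^ (k + 1) := by
    have := EisensteinSeries.linear_right_summable (1 / 2 + z / π * Complex.I) 1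
      (k := ((k + 1 : ℕ) : ℤ)) (by omega)
    simpa only [Int.cast_one, one_mul, zpow_natCast, one_div] using this
  have := h.hasSum.nat_add_neg_add_one
  push_cast at this
  simpa only [sub_eq_add_neg, neg_add] using this

theorem half_add_div_pi_mul_I_mem {z : ℝ} (hz : 0 < z) :
    (1 / 2 + z / π * Complex.I : ℂ) ∈ UpperHalfPlane.upperHalfPlaneSet := by
  have e : (1 / 2 + z / π * Complex.I : ℂ) = ((1 / 2 : ℝ) : ℂ) + ((z / π : ℝ) : ℂ) * Complex.I := by
    push_cast
    rfl
  rw [e]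
  simpa using div_pos hz pi_pos

theorem half_add_div_pi_mul_I_add_and_sub (z : ℝ) (n : ℕ) :
    (1 / 2 + z / π * Complex.I + n : ℂ) = ((2 * n + 1) * π / 2 + z * Complex.I) / π ∧
    (1 / 2 + z / π * Complex.I - (n + 1) : ℂ) = -((2 * n + 1) * π / 2 - z * Complex.I) / π := by
  have hπ : (π : ℂ) ≠ 0 := by exact_mod_cast pi_ne_zero
  constructor <;> field_simp <;> ring

theorem add_mul_I_ne_zero {b : ℝ} (hb : 0 < b) (z : ℝ) :
    (b + z * Complex.I : ℂ) ≠ 0 ∧ (b - z * Complex.I : ℂ) ≠ 0 := by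
  constructor <;>
  · intro h
    have := congrArg Complex.re h
    simp at this
    linarith

theorem hasSum_one_sub_tanh_sq {z : ℝ} (hz : 0 < z) :
    HasSum (fun n : ℕ => 2 * (((2 * n + 1) * π / 2) ^ 2 - z ^ 2) /
      (((2 * n + 1) * π / 2) ^ 2 + z ^ 2) ^ 2) (1 - Real.tanh z ^ 2) := by
  have hπ : (π : ℂ) ≠ 0 := by exact_mod_cast pi_ne_zero
  have hw := half_add_div_pi_mul_I_mem hz
  have h := (hasSum_one_div_half_add_pow z (k := 1) le_rfl).div_const ((π : ℂ) ^ 2)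
  have hd := iteratedDerivWithin_cot_pi_mul_eq_mul_tsum_div_pow (k := 1) le_rfl hw
  rw [(iteratedDerivWithin_one_three_pi_mul_cot hw).1, pi_mul_cot_half_add] at hd
  rw [← Complex.hasSum_ofReal]
  have e : (∑' n : ℤ, 1 / ((1 / 2 + z / π * Complex.I) + n : ℂ) ^ (1 + 1)) / (π : ℂ) ^ 2 =
      (1 - Real.tanh z ^ 2 : ℝ) := by
    symm
    rw [eq_div_iff (pow_ne_zero _ hπ)]
    push_cast at hd ⊢
    simp only [Nat.factorial] at hd
    push_cast at hd
    linear_combination -hd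
  rw [e] at h
  refine h.congr_fun fun n => ?_
  obtain ⟨h1, h2⟩ := add_mul_I_ne_zero (b := (2 * n + 1) * π / 2) (by positivity) z
  rw [(half_add_div_pi_mul_I_add_and_sub z n).1, (half_add_div_pi_mul_I_add_and_sub z n).2]
  push_cast at h1 h2 ⊢
  set b : ℂ := (2 * n + 1) * π / 2
  have e : b ^ 2 + (z : ℂ) ^ 2 = (b + z * Complex.I) * (b - z * Complex.I) := by
    linear_combination (z : ℂ) ^ 2 * Complex.I_sq
  have e' : b ^ 2 - (z : ℂ) ^ 2 = b ^ 2 + z ^ 2 * Complex.I ^ 2 := by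
    rw [Complex.I_sq]; ring
  rw [e, e']
  field_simp
  ring

theorem hasSum_tanh_quartic {z : ℝ} (hz : 0 < z) :
    HasSum (fun n : ℕ => 2 * (((2 * n + 1) * π / 2) ^ 4 - 6 * ((2 * n + 1) * π / 2) ^ 2 * z ^ 2
        + z ^ 4) / (((2 * n + 1) * π / 2) ^ 2 + z ^ 2) ^ 4)
      ((1 - Real.tanh z ^ 2) * (1 - 3 * Real.tanh z ^ 2) / 3) := by
  have hπ : (π : ℂ) ≠ 0 := by exact_mod_cast pi_ne_zero
  have hw := half_add_div_pi_mul_I_mem hz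
  have h := (hasSum_one_div_half_add_pow z (k := 3) (by norm_num)).div_const ((π : ℂ) ^ 4)
  have hd := iteratedDerivWithin_cot_pi_mul_eq_mul_tsum_div_pow (k := 3) (by norm_num) hw
  rw [(iteratedDerivWithin_one_three_pi_mul_cot hw).2, pi_mul_cot_half_add] at hd
  rw [← Complex.hasSum_ofReal]
  have e : (∑' n : ℤ, 1 / ((1 / 2 + z / π * Complex.I) + n : ℂ) ^ (3 + 1)) / (π : ℂ) ^ 4 =
      ((1 - Real.tanh z ^ 2) * (1 - 3 * Real.tanh z ^ 2) / 3 : ℝ) := by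
    symm
    rw [eq_div_iff (pow_ne_zero _ hπ)]
    push_cast at hd ⊢
    simp only [Nat.factorial] at hd
    push_cast at hd
    linear_combination (-1 / 6) * hd
  rw [e] at h
  refine h.congr_fun fun n => ?_
  obtain ⟨h1, h2⟩ := add_mul_I_ne_zero (b := (2 * n + 1) * π / 2) (by positivity) z
  rw [(half_add_div_pi_mul_I_add_and_sub z n).1, (half_add_div_pi_mul_I_add_and_sub z n).2]
  push_cast at h1 h2 ⊢
  set b : ℂ := (2 * n + 1) * π / 2
  have e : b ^ 2 + (z : ℂ) ^ 2 = (b + z * Complex.I) * (b - z * Complex.I) := by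
    linear_combination (z : ℂ) ^ 2 * Complex.I_sq
  have e' : 2 * (b ^ 4 - 6 * b ^ 2 * (z : ℂ) ^ 2 + z ^ 4) =
      (b + z * Complex.I) ^ 4 + (b - z * Complex.I) ^ 4 := by
    linear_combination (-12 * b ^ 2 * (z : ℂ) ^ 2 + 2 * z ^ 4 - 2 * z ^ 4 * Complex.I ^ 2)
      * Complex.I_sq
  rw [e, e']
  field_simp
  ring
theorem hasSum_tanh_pow_four_div_sq {z : ℝ} (hz : 0 < z) :
    HasSum (fun n : ℕ =>
      8 / 3 * ((3 * ((2 * n + 1) * π / 2) ^ 2 + z ^ 2) /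
        (((2 * n + 1) * π / 2) ^ 2 * (((2 * n + 1) * π / 2) ^ 2 + z ^ 2) ^ 2)) -
      2 * ((10 * ((2 * n + 1) * π / 2) ^ 6 + 5 * ((2 * n + 1) * π / 2) ^ 4 * z ^ 2 +
        4 * ((2 * n + 1) * π / 2) ^ 2 * z ^ 4 + z ^ 6) /
        (((2 * n + 1) * π / 2) ^ 4 * (((2 * n + 1) * π / 2) ^ 2 + z ^ 2) ^ 4)))
      (Real.tanh z ^ 4 / z ^ 2) := by
  have hπ : π ≠ 0 := pi_ne_zero
  have h2 := (hasSum_one_div_odd_pow hasSum_zeta_two).mul_left (32 / (3 * π ^ 2))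
  have h4 := (hasSum_one_div_odd_pow hasSum_zeta_four).mul_left (32 / π ^ 4)
  have h := ((((h2.sub h4).sub ((hasSum_one_sub_tanh_sq hz).mul_left (4 / 3))).add
    (hasSum_tanh_quartic hz)).div_const (z ^ 2))
  have e : (32 / (3 * π ^ 2) * ((1 - 1 / 2 ^ 2) * (π ^ 2 / 6)) -
      32 / π ^ 4 * ((1 - 1 / 2 ^ 4) * (π ^ 4 / 90)) - 4 / 3 * (1 - Real.tanh z ^ 2) +
      (1 - Real.tanh z ^ 2) * (1 - 3 * Real.tanh z ^ 2) / 3) / z ^ 2 =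
      Real.tanh z ^ 4 / z ^ 2 := by
    field_simp
    ring
  rw [e] at h
  refine h.congr_fun fun n => ?_
  have hn : (2 * n + 1 : ℝ) ≠ 0 := by positivity
  have e2 : 32 / (3 * π ^ 2) * (1 / (2 * n + 1 : ℝ) ^ 2) =
      8 / 3 / ((2 * n + 1) * π / 2) ^ 2 := by
    field_simp
    norm_num
  have e4 : 32 / π ^ 4 * (1 / (2 * n + 1 : ℝ) ^ 4) = 2 / ((2 * n + 1) * π / 2) ^ 4 := by
    field_simp
    norm_num
  have hb : 0 < (2 * n + 1) * π / 2 := by positivity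
  rw [e2, e4]
  generalize (2 * n + 1) * π / 2 = b at hb
  field_simp
  ring

theorem integral_tanh_pow_four_div_sq {Z₃ Z₅ : ℝ}
    (h₃ : HasSum (fun n : ℕ => 1 / (n : ℝ) ^ 3) Z₃)
    (h₅ : HasSum (fun n : ℕ => 1 / (n : ℝ) ^ 5) Z₅) :
    ∫ z in Set.Ioi (0 : ℝ), Real.tanh z ^ 4 / z ^ 2 =
      56 * Z₃ / (3 * π ^ 2) - 124 * Z₅ / π ^ 4 := by
  have hπ : π ≠ 0 := pi_ne_zero
  have hb : ∀ n : ℕ, 0 < (2 * n + 1) * π / 2 := fun n => by positivity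
  have hI₂ := fun n : ℕ => integrableOn_and_integral_double_pole (hb n)
  have hI₄ := fun n : ℕ => integrableOn_and_integral_quadruple_pole (hb n)
  have hs₃ : HasSum (fun n : ℕ => 8 / 3 * (π / ((2 * n + 1) * π / 2) ^ 3))
      (56 * Z₃ / (3 * π ^ 2)) := by
    have h := (hasSum_one_div_odd_pow h₃).mul_left (64 / (3 * π ^ 2))
    rw [show 64 / (3 * π ^ 2) * ((1 - 1 / 2 ^ 3) * Z₃) = 56 * Z₃ / (3 * π ^ 2) by ring] at h
    refine h.congr_fun fun n => ?_
    have hn : (2 * n + 1 : ℝ) ≠ 0 := by positivity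
    field_simp
    norm_num
  have hs₅ : HasSum (fun n : ℕ => 2 * (2 * π / ((2 * n + 1) * π / 2) ^ 5))
      (124 * Z₅ / π ^ 4) := by
    have h := (hasSum_one_div_odd_pow h₅).mul_left (128 / π ^ 4)
    rw [show 128 / π ^ 4 * ((1 - 1 / 2 ^ 5) * Z₅) = 124 * Z₅ / π ^ 4 by ring] at h
    refine h.congr_fun fun n => ?_
    have hn : (2 * n + 1 : ℝ) ≠ 0 := by positivity
    field_simp
    norm_num
  have hint := hasSum_integral_of_summable_integral_norm
    (μ := volume.restrict (Set.Ioi (0 : ℝ)))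
    (fun n => ((hI₂ n).1.const_mul (8 / 3)).sub ((hI₄ n).1.const_mul 2)) ?_
  · have hsum := hs₃.sub hs₅
    rw [setIntegral_congr_fun measurableSet_Ioi
      fun z hz => (hasSum_tanh_pow_four_div_sq (Set.mem_Ioi.mp hz)).tsum_eq.symm]
    refine hint.unique (hsum.congr_fun fun n => ?_)
    rw [← (hI₂ n).2, ← (hI₄ n).2, ← integral_const_mul, ← integral_const_mul]
    exact integral_sub ((hI₂ n).1.const_mul (8 / 3)) ((hI₄ n).1.const_mul 2)
  · refine (hs₃.add hs₅).summable.of_nonneg_of_le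
      (fun n => integral_nonneg fun z => norm_nonneg _) fun n => ?_
    rw [← (hI₂ n).2, ← (hI₄ n).2, ← integral_const_mul, ← integral_const_mul,
      ← integral_add ((hI₂ n).1.const_mul (8 / 3)) ((hI₄ n).1.const_mul 2)]
    refine integral_mono (((hI₂ n).1.const_mul (8 / 3)).sub ((hI₄ n).1.const_mul 2)).norm
      (((hI₂ n).1.const_mul (8 / 3)).add ((hI₄ n).1.const_mul 2)) fun z => ?_
    refine (norm_sub_le _ _).trans_eq ?_
    rw [Real.norm_of_nonneg, Real.norm_of_nonneg]
    · dsimp only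
      positivity
    · positivity

theorem stmt_2 :
    (↑(∫ z in Set.Ioi (0:ℝ), Real.tanh z ^ 4 / z ^ 2) : ℂ) = 56 * riemannZeta 3 / (3 * (π:ℂ) ^ 2) - 124 * riemannZeta 5 / (π:ℂ) ^ 4 := by
  obtain ⟨Z₃, hz₃, h₃⟩ := hasSum_one_div_natCast_pow_of_riemannZeta (s := 3) (by norm_num)
  obtain ⟨Z₅, hz₅, h₅⟩ := hasSum_one_div_natCast_pow_of_riemannZeta (s := 5) (by norm_num)
  rw [Nat.cast_ofNat] at hz₃ hz₅
  rw [integral_tanh_pow_four_div_sq h₃ h₅, hz₃, hz₅]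
  push_cast
  rfl
end

section
/- ∫₀^∞ tanh(z)⁴/z⁴ dz = -496 ζ(5)/(3π⁴) + 2540 ζ(7)/π⁶. -/
open Real MeasureTheory Filter Topology Set

theorem HasSum.odd_of_even {M : Type*} [NormedAddCommGroup M] [CompleteSpace M] {f : ℕ → M}
    {a b : M} (hf : HasSum f a) (he : HasSum (fun k ↦ f (2 * k)) b) :
    HasSum (fun k ↦ f (2 * k + 1)) (a - b) := by
  have ho : Summable fun k ↦ f (2 * k + 1) :=
    hf.summable.comp_injective (i := fun k : ℕ ↦ 2 * k + 1) fun m n h ↦ by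
      simp only at h
      omega
  have h := hf.unique (he.even_add_odd ho.hasSum)
  rw [h, add_sub_cancel_left]
  exact ho.hasSum

theorem Real.hasSum_coth_sub_inv {z : ℝ} (hz : z ≠ 0) :
    HasSum (fun n : ℕ ↦ 2 * z / (z ^ 2 + ((n : ℝ) + 1) ^ 2 * π ^ 2))
      (cosh z / sinh z - 1 / z) := by
  have hπ : (π : ℂ) ≠ 0 := by exact_mod_cast pi_ne_zero
  have hzc : (z : ℂ) ≠ 0 := by exact_mod_cast hz
  have hI := Complex.I_sq
  set x : ℂ := z / π * Complex.I with hx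
  have hxim : x.im = z / π := by
    rw [hx, ← Complex.ofReal_div]
    simp
  have hmem : x ∈ Complex.integerComplement := by
    rintro ⟨n, hn⟩
    have h := congrArg Complex.im hn
    rw [hxim] at h
    simp only [Complex.intCast_im] at h
    exact (div_ne_zero hz pi_ne_zero) h.symm
  have h := (summable_cotTerm hmem).hasSum
  have hsum : ∑' n, cotTerm x n = π * Complex.cot (π * x) - 1 / x := (cot_series_rep' hmem).symm
  rw [hsum] at h
  have hsinh : (Complex.sinh z : ℂ) ≠ 0 := by
    rw [← Complex.ofReal_sinh]
    exact_mod_cast fun h ↦ hz (Real.sinh_eq_zero.1 h)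
  have hval : (π : ℂ) * Complex.cot (π * x) - 1 / x
      = -Complex.I * π * ((cosh z / sinh z - 1 / z : ℝ) : ℂ) := by
    have : (π : ℂ) * x = z * Complex.I := by rw [hx]; field_simp
    rw [this, Complex.cot, Complex.cos_mul_I, Complex.sin_mul_I, hx]
    push_cast
    have := Complex.I_ne_zero
    field_simp
    linear_combination (Complex.cosh z * z - Complex.sinh z) * hI
  have hterm (n : ℕ) : cotTerm x n
      = -Complex.I * π * ((2 * z / (z ^ 2 + ((n : ℝ) + 1) ^ 2 * π ^ 2) : ℝ) : ℂ) := by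
    have hd : (z : ℂ) ^ 2 + ((n : ℂ) + 1) ^ 2 * π ^ 2 ≠ 0 := by
      have : z ^ 2 + ((n : ℝ) + 1) ^ 2 * π ^ 2 ≠ 0 := by positivity
      exact_mod_cast this
    have hprod : (x + (n + 1)) * (x - (n + 1))
        = -(((z : ℂ) ^ 2 + ((n : ℂ) + 1) ^ 2 * π ^ 2) / π ^ 2) := by
      rw [hx]
      field_simp
      linear_combination (z : ℂ) ^ 2 * hI
    rw [cotTerm_identity hmem, hprod, hx]
    push_cast
    field_simp
  rw [hval, funext hterm, hasSum_mul_left_iff (by simp [hπ])] at h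
  exact_mod_cast h

theorem Real.hasSum_coth_add_inv {z : ℝ} (hz : z ≠ 0) :
    HasSum (fun n : ℕ ↦ 2 * z / (z ^ 2 + (n : ℝ) ^ 2 * π ^ 2)) (cosh z / sinh z + 1 / z) := by
  rw [← hasSum_nat_add_iff' 1]
  convert! hasSum_coth_sub_inv hz using 1
  · push_cast
    rfl
  · simp
    field

/-- The positive imaginary part of the `k`-th pole of `tanh` in the upper half plane. -/
noncomputable def tanhPole (k : ℕ) : ℝ := (2 * k + 1) * π / 2

theorem tanhPole_pos (k : ℕ) : 0 < tanhPole k := by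
  unfold tanhPole
  positivity

theorem one_le_tanhPole (k : ℕ) : 1 ≤ tanhPole k := by
  unfold tanhPole
  nlinarith [two_le_pi, (Nat.cast_nonneg k : (0 : ℝ) ≤ k)]

theorem hasSum_tanh {z : ℝ} (hz : z ≠ 0) :
    HasSum (fun k ↦ 2 * z / (z ^ 2 + tanhPole k ^ 2)) (tanh z) := by
  have h2 := (hasSum_coth_add_inv (z := 2 * z) (by simpa using hz)).mul_left 2
  have h := h2.odd_of_even (b := cosh z / sinh z + 1 / z) (by
    convert! hasSum_coth_add_inv hz using 1
    ext k
    push_cast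
    field_simp)
  convert! h using 1
  · ext k
    unfold tanhPole
    push_cast
    field_simp
  · have hs : sinh z ≠ 0 := fun h ↦ hz (sinh_eq_zero.1 h)
    have hc := (cosh_pos z).ne'
    rw [tanh_eq_sinh_div_cosh, cosh_two_mul, sinh_two_mul]
    field_simp
    ring

theorem hasSum_one_div_tanhPole_pow {s : ℕ} {Z : ℝ}
    (h : HasSum (fun n : ℕ ↦ 1 / (n : ℝ) ^ s) Z) :
    HasSum (fun k ↦ 1 / tanhPole k ^ s) ((2 / π) ^ s * (1 - 1 / 2 ^ s) * Z) := by
  have he := h.mul_left (1 / 2 ^ s)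
  have ho := (h.odd_of_even (b := 1 / 2 ^ s * Z) (by
    convert! he using 2 with k
    push_cast
    rw [mul_pow, div_mul_div_comm, one_mul])).mul_left ((2 / π) ^ s)
  convert! ho using 1
  · ext k
    unfold tanhPole
    push_cast
    simp only [div_pow, mul_pow]
    field_simp
  · ring

theorem hasSum_zeta_six : HasSum (fun n : ℕ ↦ (1 : ℝ) / (n : ℝ) ^ 6) (π ^ 6 / 945) := by
  have hB : bernoulli' 6 = 1 / 42 := by
    have h5 : bernoulli' 5 = 0 := bernoulli'_eq_zero_of_odd (by decide) (by decide)
    rw [bernoulli'_def]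
    norm_num [Finset.sum_range_succ, Finset.sum_range_zero, h5, Nat.choose]
  convert! hasSum_zeta_nat three_ne_zero using 1
  simp only [Nat.reduceAdd, Nat.reduceMul, Nat.add_one_sub_one]
  rw [bernoulli_eq_bernoulli'_of_ne_one (by decide), hB]
  simp [Nat.factorial]
  ring

theorem riemannZeta_eq_ofReal_tsum {s : ℕ} (hs : 1 < s) :
    riemannZeta s = ((∑' n : ℕ, 1 / (n : ℝ) ^ s : ℝ) : ℂ) := by
  rw [zeta_nat_eq_tsum_of_gt_one hs]
  push_cast
  rfl

theorem hasSum_one_div_nat_pow_riemannZeta {s : ℕ} (hs : 1 < s) :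
    HasSum (fun n : ℕ ↦ 1 / (n : ℝ) ^ s) (riemannZeta s).re := by
  rw [riemannZeta_eq_ofReal_tsum hs, Complex.ofReal_re]
  exact (summable_one_div_nat_pow.2 hs).hasSum

theorem ofReal_re_riemannZeta {s : ℕ} (hs : 1 < s) :
    ((riemannZeta s).re : ℂ) = riemannZeta s := by
  rw [riemannZeta_eq_ofReal_tsum hs, Complex.ofReal_re]

theorem hasSum_one_div_tanhPole_sq : HasSum (fun k ↦ 1 / tanhPole k ^ 2) (1 / 2) := by
  convert! hasSum_one_div_tanhPole_pow hasSum_zeta_two using 1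
  field

theorem hasSum_one_div_tanhPole_pow_four : HasSum (fun k ↦ 1 / tanhPole k ^ 4) (1 / 6) := by
  convert! hasSum_one_div_tanhPole_pow hasSum_zeta_four using 1
  field

theorem hasSum_one_div_tanhPole_pow_six : HasSum (fun k ↦ 1 / tanhPole k ^ 6) (1 / 15) := by
  convert! hasSum_one_div_tanhPole_pow hasSum_zeta_six using 1
  field

theorem hasSum_tanh_remainder_four {z : ℝ} (hz : z ≠ 0) :
    HasSum (fun k ↦ 2 / tanhPole k ^ 4 * (z ^ 2 + tanhPole k ^ 2)⁻¹)
      ((tanh z - z + z ^ 3 / 3) / z ^ 5) := by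
  convert! (((hasSum_tanh hz).sub (hasSum_one_div_tanhPole_sq.mul_left (2 * z))).add
    (hasSum_one_div_tanhPole_pow_four.mul_left (2 * z ^ 3))).div_const (z ^ 5) using 1
  · ext k
    have := tanhPole_pos k
    field_simp
    ring
  · ring

theorem hasSum_tanh_remainder_six {z : ℝ} (hz : z ≠ 0) :
    HasSum (fun k ↦ 2 / tanhPole k ^ 6 * (z ^ 2 + tanhPole k ^ 2)⁻¹)
      (-(tanh z - z + z ^ 3 / 3 - 2 * z ^ 5 / 15) / z ^ 7) := by
  convert! ((((hasSum_tanh hz).sub (hasSum_one_div_tanhPole_sq.mul_left (2 * z))).add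
    (hasSum_one_div_tanhPole_pow_four.mul_left (2 * z ^ 3))).sub
    (hasSum_one_div_tanhPole_pow_six.mul_left (2 * z ^ 5))).neg.div_const (z ^ 7) using 1
  · ext k
    have := tanhPole_pos k
    field_simp
    ring
  · ring

theorem sq_add_sq_inv_eq {a : ℝ} (ha : a ≠ 0) (z : ℝ) :
    (z ^ 2 + a ^ 2)⁻¹ = (a ^ 2)⁻¹ * (1 + (a⁻¹ * z) ^ 2)⁻¹ := by
  field_simp
  ring

theorem integrable_inv_sq_add_sq {a : ℝ} (ha : a ≠ 0) :
    Integrable fun z : ℝ ↦ (z ^ 2 + a ^ 2)⁻¹ := by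
  simp_rw [sq_add_sq_inv_eq ha]
  exact (integrable_inv_one_add_sq.comp_mul_left' (inv_ne_zero ha)).const_mul _

theorem integral_Ioi_zero_inv_sq_add_sq {a : ℝ} (ha : 0 < a) :
    ∫ z in Ioi (0 : ℝ), (z ^ 2 + a ^ 2)⁻¹ = π / (2 * a) := by
  simp_rw [sq_add_sq_inv_eq ha.ne']
  rw [integral_const_mul, integral_comp_mul_left_Ioi (fun z ↦ (1 + z ^ 2)⁻¹) 0 (inv_pos.2 ha),
    mul_zero, integral_Ioi_inv_one_add_sq, arctan_zero, smul_eq_mul]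
  field

/-- Termwise integration over the half-line of a series of simple partial fractions. -/
theorem integral_Ioi_partialFractions {n : ℕ} {g : ℝ → ℝ} {S : ℝ}
    (hg : ∀ z : ℝ, 0 < z →
      HasSum (fun k ↦ 2 / tanhPole k ^ n * (z ^ 2 + tanhPole k ^ 2)⁻¹) (g z))
    (hS : HasSum (fun k ↦ 1 / tanhPole k ^ (n + 1)) S) :
    IntegrableOn g (Ioi 0) ∧ ∫ z in Ioi (0 : ℝ), g z = π * S := by
  have hnorm (k : ℕ) (z : ℝ) : ‖2 / tanhPole k ^ n * (z ^ 2 + tanhPole k ^ 2)⁻¹‖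
      = 2 / tanhPole k ^ n * (z ^ 2 + tanhPole k ^ 2)⁻¹ := by
    have := tanhPole_pos k
    exact norm_of_nonneg (by positivity)
  have hint (k : ℕ) : ∫ z in Ioi (0 : ℝ), 2 / tanhPole k ^ n * (z ^ 2 + tanhPole k ^ 2)⁻¹
      = π * (1 / tanhPole k ^ (n + 1)) := by
    have := tanhPole_pos k
    rw [integral_const_mul, integral_Ioi_zero_inv_sq_add_sq this]
    field
  have h := hasSum_integral_of_summable_integral_norm (μ := volume.restrict (Ioi (0 : ℝ)))
    (F := fun k z ↦ 2 / tanhPole k ^ n * (z ^ 2 + tanhPole k ^ 2)⁻¹)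
    (fun k ↦ ((integrable_inv_sq_add_sq (tanhPole_pos k).ne').const_mul _).integrableOn)
    (by simpa only [hnorm, hint] using (hS.mul_left π).summable)
  simp only [hint] at h
  have hI : ∫ z in Ioi (0 : ℝ), g z = π * S := by
    rw [← h.unique (hS.mul_left π)]
    exact setIntegral_congr_fun measurableSet_Ioi fun z hz ↦ (hg z hz).tsum_eq.symm
  have hpos : 0 < S := by
    rw [← hS.tsum_eq]
    have (k : ℕ) : 0 < 1 / tanhPole k ^ (n + 1) := by
      have := tanhPole_pos k
      positivity
    exact hS.summable.tsum_pos (fun k ↦ (this k).le) 0 (this 0)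
  exact ⟨.of_integral_ne_zero (by rw [hI]; positivity), hI⟩

theorem Real.hasDerivAt_tanh (z : ℝ) : HasDerivAt tanh (1 - tanh z ^ 2) z := by
  have hc := (cosh_pos z).ne'
  have h := (hasDerivAt_sinh z).div (hasDerivAt_cosh z) hc
  have he : (sinh / cosh : ℝ → ℝ) = tanh := by
    ext x
    exact (tanh_eq_sinh_div_cosh x).symm
  rw [he] at h
  convert! h using 1
  rw [tanh_eq_sinh_div_cosh]
  field

theorem tanh_sq_le_sq (z : ℝ) : tanh z ^ 2 ≤ z ^ 2 := by
  rcases eq_or_ne z 0 with rfl | hz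
  · simp
  have h : HasSum (fun k ↦ 2 / (z ^ 2 + tanhPole k ^ 2)) (tanh z / z) := by
    convert! (hasSum_tanh hz).div_const z using 2 with k
    field
  have h0 : 0 ≤ tanh z / z := h.nonneg fun k ↦ by positivity
  have h1 : tanh z / z ≤ 2 * (1 / 2) := by
    refine hasSum_le (fun k ↦ ?_) h (hasSum_one_div_tanhPole_sq.mul_left 2)
    have := tanhPole_pos k
    rw [mul_one_div]
    gcongr
    nlinarith [sq_nonneg z]
  have h2 : (tanh z / z) ^ 2 ≤ 1 := by nlinarith
  rwa [div_pow, div_le_one (by positivity)] at h2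

theorem tanh_sq_le_one (z : ℝ) : tanh z ^ 2 ≤ 1 := by
  nlinarith [tanh_lt_one z, neg_one_lt_tanh z]

theorem continuous_tanh : Continuous tanh :=
  continuous_iff_continuousAt.2 fun z ↦ (hasDerivAt_tanh z).continuousAt

theorem integrable_tanh_pow_four_div : Integrable fun z : ℝ ↦ tanh z ^ 4 / z ^ 4 := by
  refine (integrable_inv_one_add_sq.const_mul 2).mono'
    (((continuous_tanh.measurable.pow_const 4).div
      (measurable_id.pow_const 4)).aestronglyMeasurable) (ae_of_all _ fun z ↦ ?_)
  rw [norm_of_nonneg (by positivity)]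
  rcases eq_or_ne z 0 with rfl | hz
  · simp
  have h1 := tanh_sq_le_sq z
  have h2 := tanh_sq_le_one z
  rw [← div_eq_mul_inv, div_le_div_iff₀ (by positivity) (by positivity)]
  have h3 : tanh z ^ 2 * (1 + z ^ 2) ≤ 2 * z ^ 2 := by nlinarith [sq_nonneg z]
  calc tanh z ^ 4 * (1 + z ^ 2) = tanh z ^ 2 * (tanh z ^ 2 * (1 + z ^ 2)) := by ring
    _ ≤ z ^ 2 * (2 * z ^ 2) := by gcongr
    _ = 2 * z ^ 4 := by ring

/-- An antiderivative of `tanh z ^ 4 / z ^ 4` up to Taylor remainders of `tanh`. -/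
noncomputable def tanhPrimitive (z : ℝ) : ℝ :=
  (-(tanh z * z ^ 2) - tanh z ^ 3 * z ^ 2 / 3 + 2 / 3 * (tanh z ^ 2 * z) - 10 / 3 * tanh z
    + 10 / 3 * z - 7 / 9 * z ^ 3 + 8 / 9 * z ^ 5) / z ^ 6

theorem hasDerivAt_tanhPrimitive {z : ℝ} (hz : z ≠ 0) :
    HasDerivAt tanhPrimitive
      (tanh z ^ 4 / z ^ 4 + 16 / 3 * ((tanh z - z + z ^ 3 / 3) / z ^ 5)
        - 20 * (-(tanh z - z + z ^ 3 / 3 - 2 * z ^ 5 / 15) / z ^ 7)) z := by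
  have hT := hasDerivAt_tanh z
  have hp (n : ℕ) := hasDerivAt_pow n z
  have h := (((((((hT.mul (hp 2)).neg.sub (((hT.pow 3).mul (hp 2)).div_const 3)).add
    (((hT.pow 2).mul (hasDerivAt_id z)).const_mul (2 / 3))).sub (hT.const_mul (10 / 3))).add
    ((hasDerivAt_id z).const_mul (10 / 3))).sub ((hp 3).const_mul (7 / 9))).add
    ((hp 5).const_mul (8 / 9))).div (hp 6) (pow_ne_zero 6 hz)
  convert! h using 1
  simp
  field_simp
  ring

theorem tendsto_tanhPrimitive_atTop : Tendsto tanhPrimitive atTop (𝓝 0) := by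
  have hv : Tendsto (fun z : ℝ ↦ z⁻¹) atTop (𝓝 0) := tendsto_inv_atTop_zero
  have hu : Tendsto (fun z : ℝ ↦ tanh z * z⁻¹) atTop (𝓝 0) := by
    refine bdd_le_mul_tendsto_zero' 1 (Eventually.of_forall fun z ↦ ?_) hv
    exact abs_le.2 ⟨(neg_one_lt_tanh z).le, (tanh_lt_one z).le⟩
  have hQ : Continuous fun p : ℝ × ℝ ↦ -(p.1 * p.2 ^ 3) - p.1 ^ 3 * p.2 / 3
      + 2 / 3 * (p.1 ^ 2 * p.2 ^ 3) - 10 / 3 * (p.1 * p.2 ^ 5) + 10 / 3 * p.2 ^ 5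
      - 7 / 9 * p.2 ^ 3 + 8 / 9 * p.2 := by fun_prop
  have h := (hQ.tendsto (0, 0)).comp (hu.prodMk_nhds hv)
  simp only [ne_eq, OfNat.ofNat_ne_zero, not_false_eq_true, zero_pow, mul_zero, neg_zero, zero_div,
    sub_zero, add_zero] at h
  refine h.congr' ?_
  filter_upwards [eventually_gt_atTop 0] with z hz
  simp only [Function.comp, tanhPrimitive]
  field

theorem tendsto_tanhPrimitive_nhdsGT_zero : Tendsto tanhPrimitive (𝓝[>] 0) (𝓝 0) := by
  have hz : Tendsto (fun z : ℝ ↦ z) (𝓝[>] 0) (𝓝 0) :=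
    tendsto_nhdsWithin_of_tendsto_nhds tendsto_id
  have hw : Tendsto (fun z : ℝ ↦ -(tanh z - z + z ^ 3 / 3 - 2 * z ^ 5 / 15) / z ^ 7 * z)
      (𝓝[>] 0) (𝓝 0) := by
    refine bdd_le_mul_tendsto_zero' (2 * (1 / 15)) ?_ hz
    filter_upwards [self_mem_nhdsWithin] with z (hz : 0 < z)
    have h := hasSum_tanh_remainder_six hz.ne'
    rw [abs_of_nonneg (h.nonneg fun k ↦ by have := tanhPole_pos k; positivity)]
    refine hasSum_le (fun k ↦ ?_) h (hasSum_one_div_tanhPole_pow_six.mul_left 2)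
    have h0 := tanhPole_pos k
    rw [mul_one_div]
    refine mul_le_of_le_one_right (by positivity) (inv_le_one_of_one_le₀ ?_)
    nlinarith [one_le_tanhPole k, sq_nonneg z]
  have hQ : Continuous fun p : ℝ × ℝ ↦ 10 / 3 * p.2 + 61 / 135 * p.1 - 1 / 3 * p.1 ^ 2 * p.2
      - 41 / 135 * p.1 ^ 3 + 13 / 9 * p.1 ^ 4 * p.2 + 229 / 2025 * p.1 ^ 5
      - 38 / 45 * p.1 ^ 6 * p.2 - 22 / 675 * p.1 ^ 7 + 2 / 3 * p.1 ^ 7 * p.2 ^ 2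
      + 17 / 45 * p.1 ^ 8 * p.2 + 4 / 675 * p.1 ^ 9 - p.1 ^ 9 * p.2 ^ 2 - 4 / 45 * p.1 ^ 10 * p.2
      - 8 / 10125 * p.1 ^ 11 + 1 / 3 * p.1 ^ 11 * p.2 ^ 2 + 4 / 225 * p.1 ^ 12 * p.2
      - 2 / 15 * p.1 ^ 13 * p.2 ^ 2 + 1 / 3 * p.1 ^ 14 * p.2 ^ 3 := by fun_prop
  have h := (hQ.tendsto (0, 0)).comp (hz.prodMk_nhds hw)
  simp only [ne_eq, OfNat.ofNat_ne_zero, not_false_eq_true, zero_pow, mul_zero, sub_zero,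
    add_zero] at h
  refine h.congr' ?_
  filter_upwards [self_mem_nhdsWithin] with z (hz : 0 < z)
  simp only [Function.comp, tanhPrimitive]
  field_simp
  ring

theorem integral_tanh_pow_four_div_pow_four :
    ∫ z in Ioi (0 : ℝ), tanh z ^ 4 / z ^ 4 =
      -496 * (riemannZeta (5 : ℕ)).re / (3 * π ^ 4) + 2540 * (riemannZeta (7 : ℕ)).re / π ^ 6 := by
  have hp := pi_pos
  have hS5 := hasSum_one_div_tanhPole_pow
    (hasSum_one_div_nat_pow_riemannZeta (s := 5) (by norm_num))
  have hS7 := hasSum_one_div_tanhPole_pow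
    (hasSum_one_div_nat_pow_riemannZeta (s := 7) (by norm_num))
  obtain ⟨hi4, hI4⟩ := integral_Ioi_partialFractions (n := 4)
    (fun z hz ↦ hasSum_tanh_remainder_four hz.ne') hS5
  obtain ⟨hi6, hI6⟩ := integral_Ioi_partialFractions (n := 6)
    (fun z hz ↦ hasSum_tanh_remainder_six hz.ne') hS7
  have hi := integrable_tanh_pow_four_div.integrableOn (s := Ioi 0)
  have hadd : IntegrableOn (fun z : ℝ ↦ tanh z ^ 4 / z ^ 4
      + 16 / 3 * ((tanh z - z + z ^ 3 / 3) / z ^ 5)) (Ioi 0) := hi.add (hi4.const_mul _)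
  have hcont : ContinuousWithinAt tanhPrimitive (Ici 0) 0 := by
    rw [← continuousWithinAt_Ioi_iff_Ici, ContinuousWithinAt]
    simpa [tanhPrimitive] using tendsto_tanhPrimitive_nhdsGT_zero
  have h := integral_Ioi_of_hasDerivAt_of_tendsto hcont
    (fun z (hz : 0 < z) ↦ hasDerivAt_tanhPrimitive hz.ne')
    (hadd.sub (hi6.const_mul 20)) tendsto_tanhPrimitive_atTop
  rw [integral_sub hadd (hi6.const_mul _),
    integral_add hi (hi4.const_mul _), integral_const_mul, integral_const_mul, hI4, hI6] at h
  have h0 : tanhPrimitive 0 = 0 := by simp [tanhPrimitive]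
  rw [h0, sub_zero, sub_eq_zero] at h
  rw [eq_sub_of_add_eq h]
  field

theorem stmt_3 :
    (↑(∫ z in Set.Ioi (0:ℝ), Real.tanh z ^ 4 / z ^ 4) : ℂ) = -496 * riemannZeta 5 / (3 * (π:ℂ) ^ 4) + 2540 * riemannZeta 7 / (π:ℂ) ^ 6 := by
  rw [integral_tanh_pow_four_div_pow_four]
  push_cast
  have h5 := ofReal_re_riemannZeta (s := 5) (by norm_num)
  have h7 := ofReal_re_riemannZeta (s := 7) (by norm_num)
  push_cast at h5 h7
  rw [h5, h7]
end
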